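/- Let u, v ∈ ℂ^n be nonzero. Then the map t ↦ σ(A,u,v;t), from (0,∞) to the nonempty compact subsets of ℂ, is continuous with respect to the Hausdorff distance: for every t_0 > 0 and ε > 0 there is δ > 0 such that for all t > 0 with |t − t_0| < δ the Hausdorff distance between σ(A,u,v;t) and σ(A,u,v;t_0) is less than ε. -/

import Mathlib

open Matrix

lemma aux_root (p : Polynomial ℂ) (hp : p.Monic) (z : ℂ) (ε : ℝ) (hε : 0 < ε)
    (h : ‖p.eval z‖ < ε ^ p.natDegree) : ∃ r, p.IsRoot r ∧ dist z r ≤ ε := by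
  by_contra! hc
  have hs : p.Splits := IsAlgClosed.splits p
  have h1 : p.eval z = (p.roots.map (fun r => z - r)).prod := by
    rw [hs.eval_eq_prod_roots, hp.leadingCoeff, one_mul]
  have h2 : ∀ s : Multiset ℂ, (∀ r ∈ s, ε ≤ dist z r) →
      ε ^ s.card ≤ ‖(s.map (fun r => z - r)).prod‖ := by
    intro s
    induction s using Multiset.induction_on with
    | empty => simp
    | cons a s ih =>
      intro hh
      rw [Multiset.card_cons, Multiset.map_cons, Multiset.prod_cons, norm_mul, pow_succ']
      have ha := hh a (Multiset.mem_cons_self a s)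
      rw [dist_eq_norm] at ha
      exact mul_le_mul ha (ih fun r hr => hh r (Multiset.mem_cons_of_mem hr))
        (by positivity) (norm_nonneg _)
  have h3 := h2 p.roots (fun r hr => (hc r (Polynomial.isRoot_of_mem_roots hr)).le)
  rw [← h1, ← hs.natDegree_eq_card_roots] at h3
  linarith

lemma aux_bound {n : ℕ} (A B : Matrix (Fin n) (Fin n) ℂ) (T : ℝ) :
    ∃ R : ℝ, ∀ w z : ℂ, ‖w‖ ≤ T → z ∈ spectrum ℂ (A + w • B) → ‖z‖ ≤ R := by
  let _ : NormedRing (Matrix (Fin n) (Fin n) ℂ) := Matrix.linftyOpNormedRing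
  let _ : NormedAlgebra ℂ (Matrix (Fin n) (Fin n) ℂ) := Matrix.linftyOpNormedAlgebra
  have : CompleteSpace (Matrix (Fin n) (Fin n) ℂ) := FiniteDimensional.complete ℂ _
  refine ⟨(‖A‖ + T * ‖B‖) * ‖(1 : Matrix (Fin n) (Fin n) ℂ)‖, fun w z hw hz => ?_⟩
  refine (spectrum.norm_le_norm_mul_of_mem hz).trans ?_
  gcongr
  refine (norm_add_le _ _).trans ?_
  gcongr
  rw [norm_smul]
  gcongr

lemma aux_unif {n : ℕ} (A B : Matrix (Fin n) (Fin n) ℂ) (T ε : ℝ) (hε : 0 < ε) :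
    ∃ δ > 0, ∀ w w' z : ℂ, ‖w‖ ≤ T → ‖w'‖ ≤ T → dist w w' < δ →
      z ∈ spectrum ℂ (A + w • B) → ∃ r ∈ spectrum ℂ (A + w' • B), dist z r ≤ ε := by
  obtain ⟨R, hR⟩ := aux_bound A B T
  let F : ℂ × ℂ → ℂ := fun q => (Matrix.scalar (Fin n) q.1 - (A + q.2 • B)).det
  have hF : Continuous F := by
    apply Continuous.matrix_det
    refine Continuous.sub ?_ (by fun_prop)
    exact Continuous.matrix_diagonal (continuous_pi fun _ => continuous_fst)
  have hK : IsCompact (Metric.closedBall (0 : ℂ) R ×ˢ Metric.closedBall (0 : ℂ) T) :=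
    (isCompact_closedBall _ _).prod (isCompact_closedBall _ _)
  have hU := hK.uniformContinuousOn_of_continuous hF.continuousOn
  obtain ⟨δ, hδ, h⟩ := Metric.uniformContinuousOn_iff.1 hU (ε ^ n) (by positivity)
  refine ⟨δ, hδ, fun w w' z hw hw' hd hz => ?_⟩
  have hzR := hR w z hw hz
  have h1 := h (z, w') (by simp [hzR, hw']) (z, w) (by simp [hzR, hw])
    (by simpa [Prod.dist_eq, dist_comm, hδ] using hd)
  have h0 : F (z, w) = 0 := by
    have := Matrix.mem_spectrum_iff_isRoot_charpoly.1 hz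
    rwa [Polynomial.IsRoot, Matrix.eval_charpoly] at this
  rw [h0, dist_zero_right] at h1
  obtain ⟨r, hr, hzr⟩ := aux_root (A + w' • B).charpoly (Matrix.charpoly_monic _) z ε hε
    (by rw [Matrix.charpoly_natDegree_eq_dim, Matrix.eval_charpoly, Fintype.card_fin]; exact h1)
  exact ⟨r, Matrix.mem_spectrum_iff_isRoot_charpoly.2 hr, hzr⟩

/-- For nonzero `u, v`, the map `t ↦ σ(A,u,v;t)` is continuous on `(0,∞)`
with respect to the Hausdorff distance. -/
theorem stmt7 (n : ℕ) (hn : 1 ≤ n) (A : Matrix (Fin n) (Fin n) ℂ) (u v : Fin n → ℂ)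
    (hu : u ≠ 0) (hv : v ≠ 0)
    (S : ℝ → Set ℂ)
    (hS : S = fun t : ℝ =>
      {z : ℂ | ∃ θ ∈ Set.Ico (0 : ℝ) (2 * Real.pi),
        z ∈ spectrum ℂ
          (A + ((t : ℂ) * Complex.exp ((θ : ℂ) * Complex.I)) • vecMulVec u (star v))}) :
    ∀ t0 : ℝ, 0 < t0 → ∀ ε : ℝ, 0 < ε → ∃ δ : ℝ, 0 < δ ∧
      ∀ t : ℝ, 0 < t → |t - t0| < δ → Metric.hausdorffDist (S t) (S t0) < ε := by
  intro t0 ht0 ε hε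
  obtain ⟨δ, hδ, h⟩ := aux_unif A (vecMulVec u (star v)) (t0 + 1) (ε / 2) (by positivity)
  refine ⟨min δ 1, by positivity, fun t ht htd => ?_⟩
  have key : ∀ s s' : ℝ, 0 < s → 0 < s' → s ≤ t0 + 1 → s' ≤ t0 + 1 → |s - s'| < δ →
      ∀ z ∈ S s, ∃ y ∈ S s', dist z y ≤ ε / 2 := by
    intro s s' hs hs' h1 h2 h3 z hz
    rw [hS] at hz
    obtain ⟨θ, hθ, hz⟩ := hz
    have hn : ∀ a : ℝ, ‖(a : ℂ) * Complex.exp ((θ : ℂ) * Complex.I)‖ = |a| := by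
      intro a
      rw [norm_mul, Complex.norm_exp_ofReal_mul_I, mul_one, Complex.norm_real, Real.norm_eq_abs]
    obtain ⟨r, hr, hd⟩ := h _ ((s' : ℂ) * Complex.exp ((θ : ℂ) * Complex.I)) z
      (by rw [hn, abs_of_pos hs]; exact h1) (by rw [hn, abs_of_pos hs']; exact h2)
      (by rw [dist_eq_norm, ← sub_mul, ← Complex.ofReal_sub, hn]; exact h3) hz
    exact ⟨r, by rw [hS]; exact ⟨θ, hθ, hr⟩, hd⟩
  have hδ1 : |t - t0| < δ := htd.trans_le (min_le_left _ _)
  have ht1 : t ≤ t0 + 1 := by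
    have := (abs_lt.1 (htd.trans_le (min_le_right _ _))).2
    linarith
  refine (Metric.hausdorffDist_le_of_mem_dist (r := ε / 2) (by positivity)
    (key t t0 ht ht0 ht1 (by linarith) hδ1)
    (key t0 t ht0 ht (by linarith) ht1 (by rwa [abs_sub_comm]))).trans_lt (by linarith)
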